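/- arXiv:2011.09904 — 4 statements merged into one kernel-verified Lean document; each statement's English description precedes it below -/
import Mathlib

section
/- Let K ⊆ L be a field extension with K a perfect field, and put T = K + X·L[X]. If T is a Noetherian ring, then K ⊆ L is a separable extension. -/
/-- The polynomial composite `K + X·L[X]`: the subring of `L[X]` consisting of
all polynomials whose constant term lies in (the image of) `K`. -/
def polynomialComposite (K L : Type*) [Field K] [Field L] [Algebra K L] :
    Subring (Polynomial L) where
  carrier := {p | p.coeff 0 ∈ (algebraMap K L).range}
  mul_mem' := by
    intro a b ha hb
    simp only [Set.mem_setOf_eq, Polynomial.mul_coeff_zero] at *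
    exact mul_mem ha hb
  one_mem' := by simp
  add_mem' := by
    intro a b ha hb
    simp only [Set.mem_setOf_eq, Polynomial.coeff_add] at *
    exact add_mem ha hb
  zero_mem' := by simp
  neg_mem' := by
    intro a ha
    simp only [Set.mem_setOf_eq, Polynomial.coeff_neg] at *
    exact neg_mem ha


open Polynomial in
/-- The ideal of `K + X·L[X]` of polynomials without constant term whose linear coefficient lies in
a given `K`-subspace of `L`. -/
def polynomialComposite.linearCoeffIdeal (K L : Type*) [Field K] [Field L] [Algebra K L]
    (W : Submodule K L) : Ideal (polynomialComposite K L) where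
  carrier := {p | (p : L[X]).coeff 0 = 0 ∧ (p : L[X]).coeff 1 ∈ W}
  add_mem' := by
    rintro a b ⟨ha, ha'⟩ ⟨hb, hb'⟩
    exact ⟨by simp [ha, hb], by simpa using W.add_mem ha' hb'⟩
  zero_mem' := by simp
  smul_mem' := by
    rintro ⟨c, k, hk⟩ x ⟨hx, hx'⟩
    refine ⟨by simp [mul_coeff_zero, hx], ?_⟩
    simpa [mul_coeff_one, hx, ← hk, ← Algebra.smul_def] using W.smul_mem k hx'

open Polynomial in
theorem polynomialComposite.linearCoeffIdeal_le_iff {K L : Type*} [Field K] [Field L] [Algebra K L]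
    {V W : Submodule K L} : linearCoeffIdeal K L V ≤ linearCoeffIdeal K L W ↔ V ≤ W := by
  refine ⟨fun h v hv => ?_, fun h p hp => ⟨hp.1, h hp.2⟩⟩
  have hmem : monomial 1 v ∈ polynomialComposite K L :=
    ⟨0, by simp [coeff_monomial]⟩
  have hV : (⟨monomial 1 v, hmem⟩ : polynomialComposite K L) ∈ linearCoeffIdeal K L V :=
    ⟨by simp [coeff_monomial], by simpa [coeff_monomial] using hv⟩
  simpa [coeff_monomial] using (h hV).2

/-- If `K + X·L[X]` is Noetherian, then `L` is finite over `K`. -/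
theorem polynomialComposite.finite_of_isNoetherianRing (K L : Type*) [Field K] [Field L]
    [Algebra K L] [IsNoetherianRing (polynomialComposite K L)] : Module.Finite K L := by
  have : WellFoundedGT (Submodule K L) :=
    (OrderEmbedding.ofMapLEIff (linearCoeffIdeal K L)
      fun _ _ => linearCoeffIdeal_le_iff).strictMono.wellFoundedGT
  have : IsNoetherian K L := isNoetherian_iff'.mpr this
  infer_instance

theorem separable_of_composite_noetherian
    (K L : Type*) [Field K] [Field L] [Algebra K L] [PerfectField K]
    (hT : IsNoetherianRing (polynomialComposite K L)) :
    Algebra.IsSeparable K L := by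
  have : Module.Finite K L := polynomialComposite.finite_of_isNoetherianRing K L
  infer_instance
end

section
/- Let K ⊆ L be a field extension such that L^{G(L|K)} = K, and put T = K + X·L[X]. If T is a Noetherian ring, then K ⊆ L is a normal extension. -/
/-- If `K + X·L[X]` is Noetherian, then `L` is finite over `K`: the linear coefficients of
generators of the ideal `X·L[X]` span `L`. -/
theorem finiteDimensional_of_isNoetherianRing_polynomialComposite
    (K L : Type*) [Field K] [Field L] [Algebra K L]
    (hT : IsNoetherianRing (polynomialComposite K L)) :
    FiniteDimensional K L := by
  classical
  let I : Ideal (polynomialComposite K L) :=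
    RingHom.ker (Polynomial.constantCoeff.comp (polynomialComposite K L).subtype)
  obtain ⟨S, hS⟩ := hT.noetherian I
  let c : polynomialComposite K L → L := fun p => (p : Polynomial L).coeff 1
  have key : ∀ p ∈ Submodule.span (polynomialComposite K L) (S : Set (polynomialComposite K L)),
      c p ∈ Submodule.span K (c '' S) := by
    intro p hp
    induction hp using Submodule.span_induction with
    | mem x hx => exact Submodule.subset_span ⟨x, hx, rfl⟩
    | zero => simp [c]
    | add x y _ _ hx hy => simpa [c] using add_mem hx hy
    | smul a x hx ih =>
      have hx0 : (x : Polynomial L).coeff 0 = 0 := by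
        rw [hS] at hx
        exact hx
      obtain ⟨k, hk⟩ := a.2
      have h : c (a • x) = k • c x := by
        simp [c, Polynomial.mul_coeff_one, Algebra.smul_def, hx0, hk]
      rw [h]
      exact Submodule.smul_mem _ k ih
  refine ⟨⟨S.image c, eq_top_iff.2 fun x _ => ?_⟩⟩
  have hmem : Polynomial.C x * Polynomial.X ∈ polynomialComposite K L := by
    simp [polynomialComposite, ← Subring.mem_carrier]
  have h := key ⟨Polynomial.C x * Polynomial.X, hmem⟩ (by
    rw [hS]
    simp [I, RingHom.mem_ker])
  simpa [c] using h

theorem normal_of_composite_noetherian_of_fixedField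
    (K L : Type*) [Field K] [Field L] [Algebra K L]
    (hfix : ∀ x : L, (∀ σ : L ≃ₐ[K] L, σ x = x) → x ∈ (algebraMap K L).range)
    (hT : IsNoetherianRing (polynomialComposite K L)) :
    Normal K L := by
  have := finiteDimensional_of_isNoetherianRing_polynomialComposite K L hT
  have hG : IsGalois K L := IsGalois.of_fixedField_eq_bot K L <| eq_bot_iff.2 fun x hx =>
    IntermediateField.mem_bot.2 <| hfix x fun σ => hx ⟨σ, trivial⟩
  exact hG.to_normal
end

section
/- Let K ⊆ L be a field extension with [L : K] = 2. Then the ring K + X·L[X] is Noetherian. -/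
open Polynomial in
attribute [local instance] Polynomial.algebra in
/-- If `A` is a finite algebra over a Noetherian ring `R`, then `A[X]` is a Noetherian
`R[X]`-module. -/
theorem isNoetherian_polynomial_of_finite (R A : Type*) [CommRing R] [IsNoetherianRing R]
    [CommRing A] [Algebra R A] [Module.Finite R A] : IsNoetherian R[X] A[X] := by
  have : Module.Finite R[X] A[X] :=
    Module.Finite.equiv (Algebra.IsPushout.equiv R R[X] A A[X]).toLinearEquiv
  infer_instance

open Polynomial in
attribute [local instance] Polynomial.algebra in
/-- `K + X·L[X]` lies between `K[X]` and `L[X]`, hence is Noetherian when `L / K` is finite. -/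
theorem isNoetherianRing_polynomialComposite (K L : Type*) [Field K] [Field L] [Algebra K L]
    [Module.Finite K L] : IsNoetherianRing (polynomialComposite K L) := by
  have := isNoetherian_polynomial_of_finite K L
  let S : Subalgebra K[X] L[X] :=
    { polynomialComposite K L with
      algebraMap_mem' := fun p => ⟨p.coeff 0, by simp [Polynomial.algebraMap_def]⟩ }
  have : IsNoetherian K[X] S := inferInstanceAs (IsNoetherian K[X] (Subalgebra.toSubmodule S))
  exact (isNoetherian_of_tower K[X] this : IsNoetherian S S)

theorem composite_noetherian_of_finrank_two
    (K L : Type*) [Field K] [Field L] [Algebra K L]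
    (h : Module.finrank K L = 2) :
    IsNoetherianRing (polynomialComposite K L) := by
  have : Module.Finite K L := Module.finite_of_finrank_pos (by omega)
  exact isNoetherianRing_polynomialComposite K L
end

section
/- Let K ⊆ L be a finite field extension. Then every ideal of the ring K + X·L[X] is finitely generated. -/
open Polynomial in
/-- The inclusion of `K[X]` into `K + X·L[X]`. -/
noncomputable def polynomialComposite.mapRingHom (K L : Type*) [Field K] [Field L] [Algebra K L] :
    K[X] →+* polynomialComposite K L :=
  (Polynomial.mapRingHom (algebraMap K L)).codRestrict (polynomialComposite K L) fun p ↦ by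
    change (p.map (algebraMap K L)).coeff 0 ∈ (algebraMap K L).range
    simp

open Polynomial in
/-- For a finite extension `L / K`, the ring `K + X·L[X]` is Noetherian, being a `K[X]`-submodule
of the finite `K[X]`-module `L[X]`. -/
theorem polynomialComposite.isNoetherianRing (K L : Type*) [Field K] [Field L] [Algebra K L]
    [FiniteDimensional K L] : IsNoetherianRing (polynomialComposite K L) := by
  let _ : Algebra K[X] (polynomialComposite K L) :=
    (polynomialComposite.mapRingHom K L).toAlgebra
  let _ : Algebra K[X] L[X] := Polynomial.algebra K L
  have : Module.Finite K[X] L[X] :=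
    .equiv (Algebra.IsPushout.out (R := K) (S := K[X]) (R' := L) (S' := L[X])).equiv
  let f : polynomialComposite K L →ₗ[K[X]] L[X] :=
    { toFun := Subtype.val
      map_add' := fun _ _ ↦ rfl
      map_smul' := fun p q ↦ by
        rw [RingHom.id_apply, Algebra.smul_def, Algebra.smul_def]
        rfl }
  have : IsNoetherian K[X] (polynomialComposite K L) :=
    isNoetherian_of_injective f Subtype.val_injective
  exact isNoetherian_of_tower K[X] this

theorem ideal_fg_of_finite_extension
    (K L : Type*) [Field K] [Field L] [Algebra K L] [FiniteDimensional K L]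
    (I : Ideal (polynomialComposite K L)) :
    I.FG := by
  have := polynomialComposite.isNoetherianRing K L
  exact IsNoetherian.noetherian I
end
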